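/- arXiv:2603.14654 — 3 statements merged into one kernel-verified Lean document; each statement's English description precedes it below -/
import Mathlib

section
/- Let G be a finite abelian group and let A be a finite multiset of nonzero elements of G. Suppose 0 is not in the set Σ*(A) of nonempty subset sums of A. For each m ≥ 1, let α(m) denote the number of distinct elements of G that appear in A with multiplicity at least m. Then α(m) ≤ 32·√(|G|/m) for every positive integer m. -/
open scoped Pointwise

/-- Number of elements of `B` that leave `B` when translated by `g`. -/
def zsLam {G : Type*} [AddCommGroup G] [DecidableEq G] (B : Finset G) (g : G) : ℕ :=
  (B.filter (fun b => b + g ∉ B)).card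

lemma zsLam_add {G : Type*} [AddCommGroup G] [DecidableEq G] (B : Finset G) (g h : G) :
    zsLam B (g + h) ≤ zsLam B g + zsLam B h := by
  unfold zsLam
  have h1 : B.filter (fun b => b + (g + h) ∉ B) ⊆
      B.filter (fun b => b + g ∉ B) ∪ (B.filter (fun b => b + h ∉ B)).image (fun b => b - g) := by
    intro b hb
    simp only [Finset.mem_filter, Finset.mem_union, Finset.mem_image] at hb ⊢
    by_cases hg : b + g ∈ B
    · right
      exact ⟨b + g, ⟨hg, by rw [add_assoc]; exact hb.2⟩, by abel⟩
    · left; exact ⟨hb.1, hg⟩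
  refine (Finset.card_le_card h1).trans ((Finset.card_union_le _ _).trans ?_)
  have := Finset.card_image_le (s := B.filter (fun b => b + h ∉ B)) (f := fun b => b - g)
  omega

lemma zsLam_compl {G : Type*} [AddCommGroup G] [DecidableEq G] (B : Finset G) (g : G) :
    (B.filter (fun b => b + g ∈ B)).card + zsLam B g = B.card :=
  Finset.card_filter_add_card_filter_not _

lemma zsLam_neg {G : Type*} [AddCommGroup G] [DecidableEq G] (B : Finset G) (g : G) :
    zsLam B (-g) = zsLam B g := by
  have h1 := zsLam_compl B g
  have h2 := zsLam_compl B (-g)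
  have h3 : (B.filter (fun b => b + g ∈ B)).card = (B.filter (fun b => b + -g ∈ B)).card := by
    apply Finset.card_bij (fun b _ => b + g)
    · intro a ha
      simp only [Finset.mem_filter] at ha ⊢
      exact ⟨ha.2, by simpa using ha.1⟩
    · intro a _ b _ hab
      exact add_right_cancel hab
    · intro b hb
      simp only [Finset.mem_filter] at hb
      exact ⟨b + -g, by simpa [Finset.mem_filter] using ⟨hb.2, hb.1⟩, by abel⟩
  omega

lemma zsLam_zero {G : Type*} [AddCommGroup G] [DecidableEq G] (B : Finset G) :
    zsLam B 0 = 0 := by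
  unfold zsLam
  simp

lemma zsLam_union {G : Type*} [AddCommGroup G] [DecidableEq G] (B : Finset G) (g : G) :
    B.card + zsLam B g ≤ (B ∪ B.image (fun b => b + g)).card := by
  unfold zsLam
  have h1 : B ∪ (B.filter (fun b => b + g ∉ B)).image (fun b => b + g) ⊆
      B ∪ B.image (fun b => b + g) :=
    Finset.union_subset_union_right (Finset.image_subset_image (Finset.filter_subset _ _))
  refine le_trans ?_ (Finset.card_le_card h1)
  rw [Finset.card_union_of_disjoint, Finset.card_image_of_injective _ (add_left_injective g)]
  rw [Finset.disjoint_right]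
  intro a ha
  simp only [Finset.mem_image, Finset.mem_filter] at ha
  obtain ⟨b, hb, rfl⟩ := ha
  exact hb.2

lemma zsLam_avg {G : Type*} [AddCommGroup G] [DecidableEq G] (B X : Finset G) :
    X.card * B.card ≤ B.card * B.card + ∑ g ∈ X, zsLam B g := by
  have h1 : ∑ g ∈ X, ((B.filter (fun b => b + g ∈ B)).card + zsLam B g) = X.card * B.card := by
    rw [Finset.sum_congr rfl (fun g _ => zsLam_compl B g)]; simp
  rw [Finset.sum_add_distrib] at h1
  have h2 : ∑ g ∈ X, (B.filter (fun b => b + g ∈ B)).card ≤ B.card * B.card := by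
    have h3 : ∑ g ∈ X, (B.filter (fun b => b + g ∈ B)).card
        = ∑ b ∈ B, (X.filter (fun g => b + g ∈ B)).card :=
      Finset.sum_card_bipartiteAbove_eq_sum_card_bipartiteBelow (fun g b => b + g ∈ B)
    rw [h3]
    refine (Finset.sum_le_card_nsmul B _ B.card ?_).trans (by simp)
    intro b _
    apply Finset.card_le_card_of_injOn (fun g => b + g)
    · intro g hg
      simpa using (Finset.mem_filter.1 hg).2
    · intro a _ c _ hac
      exact add_left_cancel hac
  omega

lemma zsLam_nsmul {G : Type*} [AddCommGroup G] [DecidableEq G] (B T : Finset G) (d : ℕ)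
    (hd : ∀ x ∈ T, zsLam B x ≤ d) (j : ℕ) : ∀ x ∈ j • T, zsLam B x ≤ j * d := by
  induction j with
  | zero =>
    intro x hx
    have : x = 0 := by simpa using hx
    subst this
    rw [zsLam_zero]; simp
  | succ j ih =>
    intro x hx
    rw [succ_nsmul] at hx
    obtain ⟨y, hy, z, hz, rfl⟩ := Finset.mem_add.1 hx
    have h1 := ih y hy
    have h2 := hd z hz
    have h3 := zsLam_add B y z
    have : (j + 1) * d = j * d + d := by ring
    omega

lemma zs_stable {G : Type*} [AddCommGroup G] [Fintype G] [DecidableEq G] (T X : Finset G)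
    (hneg : ∀ x ∈ T, -x ∈ T) (hgen : AddSubgroup.closure (T : Set G) = ⊤)
    (hX : X.Nonempty) (hXT : X + T ⊆ X) : X = Finset.univ := by
  obtain ⟨x0, hx0⟩ := hX
  have key : ∀ g ∈ AddSubgroup.closure (T : Set G), ∀ y, y ∈ X ↔ y + g ∈ X := by
    intro g hg
    induction hg using AddSubgroup.closure_induction with
    | mem x hx =>
      intro y
      constructor
      · intro hy; exact hXT (Finset.add_mem_add hy hx)
      · intro hy
        have := hXT (Finset.add_mem_add hy (hneg x hx))
        simpa using this
    | zero => intro y; simp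
    | add a b _ _ ha hb =>
      intro y
      rw [ha y, hb (y + a), add_assoc]
    | neg a _ ha =>
      intro y
      have := ha (y + -a)
      simp only [neg_add_cancel_right] at this
      exact this.symm
  ext y
  simp only [Finset.mem_univ, iff_true]
  have := (key (y - x0) (by rw [hgen]; trivial) x0).1 hx0
  simpa using this

lemma zs_nsmul_card {G : Type*} [AddCommGroup G] [Fintype G] [DecidableEq G] (T : Finset G)
    (h0 : (0 : G) ∈ T)
    (hneg : ∀ x ∈ T, -x ∈ T) (hgen : AddSubgroup.closure (T : Set G) = ⊤) (i : ℕ) :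
    (3 * i + 1) • T = Finset.univ ∨ (i + 1) * T.card ≤ ((3 * i + 1) • T).card := by
  have mono : ∀ n : ℕ, n • T ⊆ (n + 1) • T := by
    intro n x hx
    rw [succ_nsmul]
    simpa using Finset.add_mem_add hx h0
  have hne : ∀ n : ℕ, (0 : G) ∈ n • T := by
    intro n
    induction n with
    | zero => simp
    | succ n ih => exact mono n ih
  induction i with
  | zero => right; simp
  | succ i ih =>
    by_cases hu : (3 * (i + 1) + 1) • T = Finset.univ
    · left; exact hu
    right
    have hnu : (3 * i + 1) • T ≠ Finset.univ ∧ (3 * i + 2) • T ≠ Finset.univ := by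
      have a1 := mono (3 * i + 1)
      have a2 := mono (3 * i + 2)
      have a3 := mono (3 * i + 3)
      constructor
      · intro h
        apply hu
        rw [h] at a1
        exact Finset.univ_subset_iff.1 ((a1.trans a2).trans a3)
      · intro h
        apply hu
        rw [h] at a2
        exact Finset.univ_subset_iff.1 (a2.trans a3)
    have ih' := ih.resolve_left hnu.1
    have hns : ¬ ((3 * i + 2) • T + T ⊆ (3 * i + 2) • T) := fun h =>
      hnu.2 (zs_stable T _ hneg hgen ⟨0, hne _⟩ h)
    obtain ⟨y, hy, hy2⟩ := Finset.not_subset.1 hns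
    rw [← succ_nsmul] at hy
    have hsub : (3 * i + 1) • T ∪ T.image (fun t => y + t) ⊆ (3 * (i + 1) + 1) • T := by
      apply Finset.union_subset
      · exact ((mono (3 * i + 1)).trans (mono (3 * i + 2))).trans (mono (3 * i + 3))
      · intro z hz
        obtain ⟨t, ht, rfl⟩ := Finset.mem_image.1 hz
        have : (3 * (i + 1) + 1) • T = (3 * i + 2 + 1) • T + T := by
          rw [← succ_nsmul]; congr 1
        rw [this]
        exact Finset.add_mem_add hy ht
    have hdis : Disjoint ((3 * i + 1) • T) (T.image (fun t => y + t)) := by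
      rw [Finset.disjoint_right]
      intro z hz hz2
      obtain ⟨t, ht, rfl⟩ := Finset.mem_image.1 hz
      apply hy2
      have := Finset.add_mem_add hz2 (hneg t ht)
      rw [← succ_nsmul] at this
      simpa using this
    have hc := Finset.card_le_card hsub
    rw [Finset.card_union_of_disjoint hdis,
      Finset.card_image_of_injective _ (add_right_injective y)] at hc
    have : (i + 1 + 1) * T.card = (i + 1) * T.card + T.card := by ring
    omega

lemma zs_growth {G : Type*} [AddCommGroup G] [Fintype G] [DecidableEq G] (S B : Finset G)
    (q : ℕ) (hq : 1 ≤ q) (hS : 12 * q ≤ S.card)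
    (hgen : AddSubgroup.closure (S : Set G) = ⊤) (hB : q ≤ B.card)
    (hBG : 2 * B.card ≤ Fintype.card G) :
    ∃ x ∈ S, 3 * B.card + q ≤ 3 * (B ∪ B.image (fun b => b + x)).card := by
  by_contra hcon
  push Not at hcon
  set T : Finset G := insert 0 (S ∪ S.image (fun x => -x)) with hT
  have hST : S ⊆ T := by
    intro x hx; simp [hT, hx]
  have h0 : (0 : G) ∈ T := by simp [hT]
  have hneg : ∀ x ∈ T, -x ∈ T := by
    intro x hx
    simp only [hT, Finset.mem_insert, Finset.mem_union, Finset.mem_image] at hx ⊢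
    rcases hx with rfl | hx | ⟨a, ha, rfl⟩
    · simp
    · right; right; exact ⟨x, hx, rfl⟩
    · right; left; simpa using ha
  have hgT : AddSubgroup.closure (T : Set G) = ⊤ := by
    rw [eq_top_iff, ← hgen]
    exact AddSubgroup.closure_mono (by exact_mod_cast hST)
  have hlS : ∀ x ∈ S, 3 * zsLam B x < q := by
    intro x hx
    have h1 := hcon x hx
    have h2 := zsLam_union B x
    omega
  have hlT : ∀ x ∈ T, zsLam B x ≤ (q - 1) / 3 := by
    intro x hx
    simp only [hT, Finset.mem_insert, Finset.mem_union, Finset.mem_image] at hx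
    rcases hx with rfl | hx | ⟨a, ha, rfl⟩
    · rw [zsLam_zero]; simp
    · have := hlS x hx; omega
    · rw [zsLam_neg]; have := hlS a ha; omega
  have hTc : 12 * q ≤ T.card := hS.trans (Finset.card_le_card hST)
  set b := B.card with hb
  set t := T.card with ht
  -- choose i
  set i := 2 * b / t with hi
  have hi1 : i * t ≤ 2 * b := Nat.div_mul_le_self _ _
  have hi2 : 2 * b ≤ (i + 1) * t := by
    have := Nat.lt_div_mul_add (a := 2 * b) (b := t) (by omega)
    rw [← hi] at this
    have h2 : (i + 1) * t = i * t + t := by ring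
    omega
  set X := (3 * i + 1) • T with hXdef
  have hXc : 2 * b ≤ X.card := by
    rcases zs_nsmul_card T h0 hneg hgT i with h | h
    · rw [hXdef, h, Finset.card_univ]; exact hBG
    · exact hi2.trans h
  have hlX : ∀ x ∈ X, zsLam B x ≤ (3 * i + 1) * ((q - 1) / 3) := zsLam_nsmul B T _ hlT _
  have havg := zsLam_avg B X
  have hsum : ∑ g ∈ X, zsLam B g ≤ X.card * ((3 * i + 1) * ((q - 1) / 3)) := by
    simpa using Finset.sum_le_card_nsmul X _ _ hlX
  -- b ≤ 2 * (3i+1) * d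
  set d := (q - 1) / 3 with hd
  have hd3 : 3 * d + 1 ≤ q := by omega
  set e := (3 * i + 1) * d with he
  rw [← hb] at havg
  have hbe : b ≤ 2 * e := by
    by_contra hlt
    push Not at hlt
    have h1 : X.card * b ≤ b * b + X.card * e := by omega
    have h2 : 2 * (b * b) ≤ X.card * b := by nlinarith
    have hXpos : 0 < X.card := by omega
    nlinarith
  have h12 : i * (12 * q) ≤ 2 * b := (Nat.mul_le_mul_left i hTc).trans hi1
  have h3e : 3 * e ≤ (3 * i + 1) * (q - 1) := by
    have : 3 * d ≤ q - 1 := by omega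
    calc 3 * e = (3 * i + 1) * (3 * d) := by rw [he]; ring
      _ ≤ _ := Nat.mul_le_mul_left _ this
  obtain ⟨r, rfl⟩ : ∃ r, q = r + 1 := ⟨q - 1, by omega⟩
  simp only [Nat.add_sub_cancel] at h3e
  nlinarith

lemma zs_small {G : Type*} [AddCommGroup G] [DecidableEq G] (A : Multiset G) :
    (∀ s : Multiset G, s ≤ A → s ≠ 0 → s.sum ≠ 0) →
    ∃ B : Finset G, A.card + 1 ≤ B.card ∧ ∀ b ∈ B, ∃ s ≤ A, s.sum = b := by
  induction A using Multiset.induction with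
  | empty =>
    intro _
    exact ⟨{0}, by simp, fun b hb => ⟨0, le_rfl, by simpa using (Finset.mem_singleton.1 hb).symm⟩⟩
  | cons a A ih =>
    intro h
    obtain ⟨B, hB, hs⟩ := ih (fun s hs => h s (hs.trans (Multiset.le_cons_self A a)))
    refine ⟨insert (a + A.sum) B, ?_, ?_⟩
    · rw [Finset.card_insert_of_notMem]
      · simp; omega
      · intro hmem
        obtain ⟨s, hsA, hsum⟩ := hs _ hmem
        apply h (a ::ₘ (A - s)) ((Multiset.cons_le_cons_iff a).2 (Multiset.sub_le_self A s))
          (Multiset.cons_ne_zero)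
        have : (A - s).sum + s.sum = A.sum := by
          rw [← Multiset.sum_add, Multiset.sub_add_cancel hsA]
        rw [Multiset.sum_cons, ← add_right_cancel_iff (a := s.sum), add_assoc, this, hsum, zero_add]
    · intro b hb
      rcases Finset.mem_insert.1 hb with rfl | hb
      · exact ⟨a ::ₘ A, le_rfl, by simp⟩
      · obtain ⟨s, h1, h2⟩ := hs b hb
        exact ⟨s, h1.trans (Multiset.le_cons_self A a), h2⟩

lemma zs_count {G : Type*} [DecidableEq G] (S : Finset G) (m : ℕ) (g : G) :
    (m • S.val).count g = if g ∈ S then m else 0 := by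
  rw [Multiset.count_nsmul]
  split_ifs with h
  · rw [Multiset.count_eq_one_of_mem S.nodup h, mul_one]
  · rw [Multiset.count_eq_zero_of_notMem (by simpa using h), mul_zero]

lemma zs_remaining {G : Type*} [DecidableEq G] (S : Finset G) (m q : ℕ) (hm : 1 ≤ m)
    (U : Multiset G) (hU : U.card ≤ m * q) :
    S.card ≤ (m • S.val - U).toFinset.card + q ∧ (m • S.val - U).toFinset ⊆ S := by
  have hsub : (m • S.val - U).toFinset ⊆ S := by
    intro x hx
    have := Multiset.mem_of_le (Multiset.sub_le_self _ _) (Multiset.mem_toFinset.1 hx)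
    simpa using Multiset.mem_of_mem_nsmul this
  refine ⟨?_, hsub⟩
  have h1 := Finset.card_sdiff_add_card_eq_card hsub
  set D := S \ (m • S.val - U).toFinset with hD
  have h2 : m • D.val ≤ U := by
    rw [Multiset.le_iff_count]
    intro g
    rw [zs_count]
    split_ifs with hg
    · have hgS := (Finset.mem_sdiff.1 hg).1
      rw [hD, Finset.mem_sdiff, Multiset.mem_toFinset, ← Multiset.count_pos,
        Multiset.count_sub, zs_count, if_pos hgS] at hg
      omega
    · exact Nat.zero_le _
  have h3 := Multiset.card_le_card h2
  rw [Multiset.card_nsmul] at h3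
  have h4 : m * D.card ≤ m * q := by
    refine le_trans ?_ hU
    simpa using h3
  have h5 := Nat.le_of_mul_le_mul_left h4 (by omega)
  omega

lemma zs_process {G : Type*} [AddCommGroup G] [Fintype G] [DecidableEq G] (S : Finset G)
    (m q : ℕ) (hm : 1 ≤ m) (hq : 1 ≤ q) (hk : 16 * q ≤ S.card)
    (hgen : ∀ S' ⊆ S, S.card ≤ S'.card + 4 * q → AddSubgroup.closure (S' : Set G) = ⊤)
    (U0 : Multiset G) (hU0 : U0.card ≤ 2 * (m * q)) (n : ℕ) (hn : n ≤ m * q) :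
    ∃ U : Multiset G, U ≤ m • S.val - U0 ∧ U.card ≤ q + n ∧ ∃ B : Finset G, q ≤ B.card ∧
      (Fintype.card G < 2 * B.card ∨ n * q ≤ 3 * B.card) ∧ ∀ b ∈ B, ∃ s ≤ U, s.sum = b := by
  have hqm : q ≤ m * q := Nat.le_mul_of_pos_left q (by omega)
  induction n with
  | zero =>
    obtain ⟨h1, h2⟩ := zs_remaining S m (4 * q) hm U0 (by nlinarith)
    obtain ⟨Q, hQ, hQc⟩ := Finset.exists_subset_card_eq
      (s := (m • S.val - U0).toFinset) (n := q) (by omega)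
    refine ⟨Q.val, ?_, by simp [hQc], Q, hQc.ge, Or.inr (by simp), ?_⟩
    · rw [Multiset.le_iff_subset Q.nodup]
      intro x hx
      exact Multiset.mem_toFinset.1 (hQ hx)
    · intro b hb
      exact ⟨{b}, by simpa using hb, by simp⟩
  | succ n ih =>
    obtain ⟨U, hU, hUc, B, hB, hor, hs⟩ := ih (by omega)
    by_cases hbig : Fintype.card G < 2 * B.card
    · exact ⟨U, hU, by omega, B, hB, Or.inl hbig, hs⟩
    have hor' := hor.resolve_left hbig
    obtain ⟨h1, h2⟩ := zs_remaining S m (4 * q) hm (U0 + U) (by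
      rw [Multiset.card_add]; nlinarith)
    obtain ⟨x, hx, hxB⟩ := zs_growth (m • S.val - (U0 + U)).toFinset B q hq (by omega)
      (hgen _ h2 h1) hB (by omega)
    refine ⟨x ::ₘ U, ?_, by simp; omega, B ∪ B.image (fun b => b + x), ?_, Or.inr ?_, ?_⟩
    · have hx' := Multiset.mem_toFinset.1 hx
      rw [← tsub_tsub] at hx'
      have h3 : {x} ≤ m • S.val - U0 - U := by simpa using hx'
      rw [← Multiset.singleton_add]
      exact (add_le_add_left h3 U).trans (by rw [tsub_add_cancel_of_le hU])
    · exact hB.trans (Finset.card_le_card Finset.subset_union_left)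
    · have : (n + 1) * q = n * q + q := by ring
      omega
    · intro b hb
      rcases Finset.mem_union.1 hb with hb | hb
      · obtain ⟨s, h3, h4⟩ := hs b hb
        exact ⟨s, h3.trans (Multiset.le_cons_self U x), h4⟩
      · obtain ⟨c, hc, rfl⟩ := Finset.mem_image.1 hb
        obtain ⟨s, h3, h4⟩ := hs c hc
        exact ⟨x ::ₘ s, (Multiset.cons_le_cons_iff x).2 h3, by simp [h4, add_comm]⟩

lemma zs_core_gen {G : Type*} [AddCommGroup G] [Fintype G] [DecidableEq G] (S : Finset G)
    (m q : ℕ) (hm : 1 ≤ m) (hq : 1 ≤ q) (hk : 16 * q ≤ S.card)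
    (hgen : ∀ S' ⊆ S, S.card ≤ S'.card + 4 * q → AddSubgroup.closure (S' : Set G) = ⊤)
    (hz : ∀ s : Multiset G, s ≤ m • S.val → s ≠ 0 → s.sum ≠ 0) :
    2 * (m * q * q) ≤ 3 * Fintype.card G := by
  have hqm : q ≤ m * q := Nat.le_mul_of_pos_left q (by omega)
  obtain ⟨U1, hU1, hc1, B1, -, ho1, hs1⟩ :=
    zs_process S m q hm hq hk hgen 0 (by simp) (m * q) le_rfl
  obtain ⟨U2, hU2, hc2, B2, -, ho2, hs2⟩ :=
    zs_process S m q hm hq hk hgen U1 (by omega) (m * q) le_rfl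
  by_cases hb1 : Fintype.card G < 2 * B1.card
  swap
  · have := ho1.resolve_left hb1; omega
  by_cases hb2 : Fintype.card G < 2 * B2.card
  swap
  · have := ho2.resolve_left hb2; omega
  exfalso
  obtain ⟨h1, h2⟩ := zs_remaining S m (4 * q) hm (U1 + U2) (by
      rw [Multiset.card_add]; nlinarith)
  have hne : (m • S.val - (U1 + U2)).toFinset.Nonempty := by
    rw [← Finset.card_pos]; omega
  obtain ⟨x, hx⟩ := hne
  have hx' := Multiset.mem_toFinset.1 hx
  have hinter : ¬ Disjoint B1 (B2.image (fun b => -x - b)) := by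
    intro hd
    have h3 := Finset.card_le_univ (B1 ∪ B2.image (fun b => -x - b))
    rw [Finset.card_union_of_disjoint hd, Finset.card_image_of_injective _ (sub_right_injective)]
      at h3
    omega
  rw [Finset.not_disjoint_iff] at hinter
  obtain ⟨c, hcB1, hcB2⟩ := hinter
  obtain ⟨b, hb, hbc⟩ := Finset.mem_image.1 hcB2
  obtain ⟨s1, hs1U, hs1s⟩ := hs1 c hcB1
  obtain ⟨s2, hs2U, hs2s⟩ := hs2 b hb
  have hle : U1 + U2 ≤ m • S.val := by
    have h0 : U1 ≤ m • S.val := by simpa using hU1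
    calc U1 + U2 ≤ U1 + (m • S.val - U1) := add_le_add_right hU2 U1
      _ = m • S.val := add_tsub_cancel_of_le h0
  have hfin : x ::ₘ (s1 + s2) ≤ m • S.val := by
    have h3 : {x} ≤ m • S.val - (U1 + U2) := by simpa using hx'
    rw [← Multiset.singleton_add]
    calc {x} + (s1 + s2) ≤ (m • S.val - (U1 + U2)) + (U1 + U2) :=
          add_le_add h3 (add_le_add hs1U hs2U)
      _ = m • S.val := tsub_add_cancel_of_le hle
  apply hz _ hfin Multiset.cons_ne_zero
  rw [Multiset.sum_cons, Multiset.sum_add, hs1s, hs2s, ← hbc]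
  abel

lemma zs_core (N : ℕ) : ∀ {G : Type*} [AddCommGroup G] [Fintype G] [DecidableEq G]
    (S : Finset G) (m : ℕ), Fintype.card G ≤ N → 1 ≤ m →
    (∀ s : Multiset G, s ≤ m • S.val → s ≠ 0 → s.sum ≠ 0) →
    m * S.card ^ 2 ≤ 1024 * Fintype.card G := by
  induction N with
  | zero =>
    intro G _ _ _ S m hN
    have := Fintype.card_pos (α := G)
    omega
  | succ N ih =>
    intro G _ _ _ S m hN hm hz
    by_cases hk : S.card ≤ 1024
    · obtain ⟨B, hB, -⟩ := zs_small (m • S.val) hz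
      have h1 := Finset.card_le_univ B
      have h2 : m * S.card ≤ Fintype.card G := by
        have : (m • S.val).card = m * S.card := by simp
        omega
      nlinarith
    push Not at hk
    obtain ⟨q, hq⟩ : ∃ q, q = S.card / 16 := ⟨_, rfl⟩
    by_cases hgen : ∀ S' ⊆ S, S.card ≤ S'.card + 4 * q → AddSubgroup.closure (S' : Set G) = ⊤
    · have h1 := zs_core_gen S m q hm (by omega) (by omega) hgen hz
      have h2 : S.card ≤ 17 * q := by omega
      have h3 : S.card ^ 2 ≤ (17 * q) ^ 2 := Nat.pow_le_pow_left h2 2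
      calc m * S.card ^ 2 ≤ m * (17 * q) ^ 2 := Nat.mul_le_mul_left m h3
        _ = 289 * (m * q * q) := by ring
        _ ≤ _ := by omega
    · push Not at hgen
      obtain ⟨S', hS', hc, hne⟩ := hgen
      classical
      set H := AddSubgroup.closure (S' : Set G) with hH
      have hcard : 2 * Fintype.card H ≤ Fintype.card G := by
        have h1 := AddSubgroup.card_mul_index H
        have h2 : H.index ≠ 1 := fun h => hne (AddSubgroup.index_eq_one.1 h)
        have h3 : H.index ≠ 0 := AddSubgroup.index_ne_zero_of_finite
        rw [Nat.card_eq_fintype_card, Nat.card_eq_fintype_card] at h1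
        have h4 : 2 ≤ H.index := by omega
        nlinarith
      have hpos := Fintype.card_pos (α := H)
      set R : Finset H := S'.subtype (fun x => x ∈ H) with hR
      have hRmap : R.map (Function.Embedding.subtype _) = S' :=
        Finset.subtype_map_of_mem (fun x hx => AddSubgroup.subset_closure hx)
      have hRcard : R.card = S'.card := by rw [← hRmap, Finset.card_map]
      have hi := ih R m (by omega) hm (by
        intro s hs hs0 hsum
        apply hz (s.map H.subtype)
        · refine (Multiset.map_le_map hs).trans ?_
          rw [Multiset.map_nsmul]
          have : R.val.map H.subtype = S'.val := by
            rw [← hRmap]; rfl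
          rw [this]
          exact nsmul_le_nsmul_right (Finset.val_le_iff.2 hS') m
        · simpa using hs0
        · rw [← map_multiset_sum, hsum, map_zero])
      rw [hRcard] at hi
      have h5 : 3 * S.card ≤ 4 * S'.card := by omega
      have h6 : (3 * S.card) ^ 2 ≤ (4 * S'.card) ^ 2 := Nat.pow_le_pow_left h5 2
      have h7 : m * (3 * S.card) ^ 2 ≤ m * (4 * S'.card) ^ 2 := Nat.mul_le_mul_left m h6
      have h8 : m * (3 * S.card) ^ 2 = 9 * (m * S.card ^ 2) := by ring
      have h9 : m * (4 * S'.card) ^ 2 = 16 * (m * S'.card ^ 2) := by ring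
      omega

theorem zero_sum_free_multiplicity_bound {G : Type*} [AddCommGroup G] [Fintype G] [DecidableEq G]
    (A : Multiset G) (hA : ∀ a ∈ A, a ≠ 0)
    (hzsf : ∀ s : Multiset G, s ≤ A → s ≠ 0 → s.sum ≠ 0)
    (m : ℕ) (hm : 1 ≤ m) :
    ((A.toFinset.filter (fun g => m ≤ A.count g)).card : ℝ) ≤
      32 * Real.sqrt ((Fintype.card G : ℝ) / m) := by
  set S := A.toFinset.filter (fun g => m ≤ A.count g) with hS
  have hle : m • S.val ≤ A := by
    rw [Multiset.le_iff_count]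
    intro g
    rw [zs_count]
    split_ifs with hg
    · exact (Finset.mem_filter.1 hg).2
    · exact Nat.zero_le _
  have h := zs_core (Fintype.card G) S m le_rfl hm (fun s hs => hzsf s (hs.trans hle))
  have hR : (m : ℝ) * (S.card : ℝ) ^ 2 ≤ 1024 * (Fintype.card G : ℝ) := by exact_mod_cast h
  have hm0 : (0 : ℝ) < m := by exact_mod_cast hm
  have h1 : (S.card : ℝ) / 32 ≤ Real.sqrt ((Fintype.card G : ℝ) / m) := by
    apply Real.le_sqrt_of_sq_le
    rw [le_div_iff₀ hm0]
    nlinarith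
  linarith
end

section
/- Let G be a finite abelian group. If A is a multiset of elements of G containing at least 32·√|G| distinct nonzero elements, then 0 belongs to Σ*(A), the set of nonempty subset sums of A. -/
section Aux
universe u

/-- number of `b ∈ B` with `b + x ∉ B`. -/
def lamZ {G : Type u} [AddCommGroup G] [DecidableEq G] (B : Finset G) (x : G) : ℕ :=
  (B.filter (fun b => b + x ∉ B)).card

theorem lamZ_zero {G : Type u} [AddCommGroup G] [DecidableEq G] (B : Finset G) :
    lamZ B 0 = 0 := by
  simp [lamZ]

theorem lamZ_add_le {G : Type u} [AddCommGroup G] [DecidableEq G] (B : Finset G) (x y : G) :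
    lamZ B (x + y) ≤ lamZ B x + lamZ B y := by
  unfold lamZ
  have h : B.filter (fun b => b + (x + y) ∉ B) ⊆
      B.filter (fun b => b + x ∉ B) ∪ (B.filter (fun b => b + y ∉ B)).image (fun b => b - x) := by
    intro b hb
    simp only [Finset.mem_filter, Finset.mem_union, Finset.mem_image] at hb ⊢
    by_cases hx : b + x ∈ B
    · right
      refine ⟨b + x, ⟨hx, ?_⟩, by abel⟩
      rw [add_assoc]; exact hb.2
    · left; exact ⟨hb.1, hx⟩
  calc _ ≤ _ := Finset.card_le_card h
    _ ≤ _ := Finset.card_union_le _ _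
    _ ≤ _ := Nat.add_le_add_left Finset.card_image_le _

theorem lamZ_add_card {G : Type u} [AddCommGroup G] [DecidableEq G] (B : Finset G) (x : G) :
    (B.filter (fun b => b + x ∈ B)).card + lamZ B x = B.card := by
  unfold lamZ
  exact Finset.card_filter_add_card_filter_not (s := B) (fun b => b + x ∈ B)

theorem lamZ_neg {G : Type u} [AddCommGroup G] [DecidableEq G] (B : Finset G) (x : G) :
    lamZ B (-x) = lamZ B x := by
  have h1 := lamZ_add_card B x
  have h2 := lamZ_add_card B (-x)
  have h3 : (B.filter (fun b => b + x ∈ B)).card = (B.filter (fun b => b + -x ∈ B)).card := by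
    apply Finset.card_bij (fun b _ => b + x)
    · intro b hb
      simp only [Finset.mem_filter] at hb ⊢
      refine ⟨hb.2, ?_⟩
      simpa using hb.1
    · intro a _ b _ hab
      exact add_right_cancel hab
    · intro b hb
      simp only [Finset.mem_filter] at hb
      refine ⟨b + -x, ?_, by abel⟩
      simp only [Finset.mem_filter]
      refine ⟨hb.2, ?_⟩
      simpa using hb.1
  omega

theorem lamZ_compl {G : Type u} [AddCommGroup G] [Fintype G] [DecidableEq G]
    (B : Finset G) (x : G) : lamZ Bᶜ x = lamZ B x := by
  rw [← lamZ_neg B x]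
  unfold lamZ
  apply Finset.card_bij (fun b _ => b + x)
  · intro b hb
    simp only [Finset.mem_filter, Finset.mem_compl, not_not] at hb ⊢
    refine ⟨hb.2, ?_⟩
    simpa using hb.1
  · intro a _ b _ hab
    exact add_right_cancel hab
  · intro b hb
    simp only [Finset.mem_filter] at hb
    refine ⟨b + -x, ?_, by abel⟩
    simp only [Finset.mem_filter, Finset.mem_compl, not_not]
    refine ⟨hb.2, ?_⟩
    simpa using hb.1

theorem lamZ_avg {G : Type u} [AddCommGroup G] [DecidableEq G] (D L : Finset G) (r : ℕ)
    (hL : ∀ x ∈ L, lamZ D x ≤ r) (hD : 0 < D.card) (hc : 2 * D.card ≤ L.card) :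
    D.card ≤ 2 * r := by
  have h1 : ∑ x ∈ L, (D.filter (fun b => b + x ∈ D)).card ≤ D.card * D.card := by
    have : ∑ x ∈ L, (D.filter (fun b => b + x ∈ D)).card
        = ∑ b ∈ D, (L.filter (fun x => b + x ∈ D)).card := by
      simp only [Finset.card_filter]
      exact Finset.sum_comm
    rw [this]
    calc _ ≤ ∑ b ∈ D, D.card := by
          apply Finset.sum_le_sum
          intro b _
          apply Finset.card_le_card_of_injOn (fun x => b + x)
          · intro x hx
            simp only [Finset.coe_filter, Set.mem_setOf_eq] at hx
            exact hx.2
          · intro x _ y _ hxy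
            exact add_left_cancel hxy
      _ = _ := by simp
  have h2 : ∑ x ∈ L, D.card ≤ ∑ x ∈ L, ((D.filter (fun b => b + x ∈ D)).card + r) := by
    apply Finset.sum_le_sum
    intro x hx
    have := lamZ_add_card D x
    have := hL x hx
    omega
  rw [Finset.sum_add_distrib] at h2
  simp only [Finset.sum_const, smul_eq_mul] at h2
  by_contra hcon
  push Not at hcon
  nlinarith

/-- level set growth -/
theorem lamZ_growth {G : Type u} [AddCommGroup G] [Fintype G] [DecidableEq G]
    (D T : Finset G) (m : ℕ) (hT : ∀ a ∈ T, lamZ D a ≤ m)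
    (hgen : AddSubgroup.closure (T : Set G) = ⊤) (s : ℕ) :
    (Finset.univ.filter (fun x => lamZ D x ≤ (3 * s + 1) * m)) = Finset.univ ∨
    (s + 1) * T.card ≤ (Finset.univ.filter (fun x => lamZ D x ≤ (3 * s + 1) * m)).card := by
  induction s with
  | zero =>
    right
    simp only [mul_zero, zero_add, one_mul]
    apply Finset.card_le_card
    intro a ha
    simpa using hT a ha
  | succ s ih =>
    by_cases hcl : ∀ y, lamZ D y ≤ (3 * s + 2) * m → ∀ a ∈ T, lamZ D (y + a) ≤ (3 * s + 2) * m
    · left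
      have key : ∀ x : G, lamZ D x ≤ (3 * s + 2) * m := by
        intro x
        have hx : x ∈ AddSubgroup.closure (T : Set G) := by rw [hgen]; trivial
        rw [← AddSubgroup.mem_toAddSubmonoid, AddSubgroup.closure_toAddSubmonoid_of_finite] at hx
        induction hx using AddSubmonoid.closure_induction_right with
        | zero => simp [lamZ_zero]
        | add_right y hy a ha ih2 => exact hcl y ih2 a ha
      ext x
      simp only [Finset.mem_filter, Finset.mem_univ, true_and, iff_true]
      have := key x
      nlinarith
    · push Not at hcl
      obtain ⟨y, hy, a, ha, hya⟩ := hcl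
      right
      have ih' : (s + 1) * T.card ≤
          (Finset.univ.filter (fun x => lamZ D x ≤ (3 * s + 1) * m)).card := by
        rcases ih with ih | ih
        · have : y + a ∈ (Finset.univ.filter (fun x => lamZ D x ≤ (3 * s + 1) * m)) := by
            rw [ih]; simp
          simp only [Finset.mem_filter, Finset.mem_univ, true_and] at this
          nlinarith
        · exact ih
      have hdis : Disjoint (Finset.univ.filter (fun x => lamZ D x ≤ (3 * s + 1) * m))
          (T.image (fun c => (y + a) + c)) := by
        rw [Finset.disjoint_left]
        intro z hz hz2
        simp only [Finset.mem_filter, Finset.mem_univ, true_and, Finset.mem_image] at hz hz2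
        obtain ⟨c, hc, rfl⟩ := hz2
        have h1 := lamZ_add_le D (y + a + c) (-c)
        rw [lamZ_neg, add_neg_cancel_right] at h1
        have h2 := hT c hc
        nlinarith
      have hsub : (Finset.univ.filter (fun x => lamZ D x ≤ (3 * s + 1) * m)) ∪
          (T.image (fun c => (y + a) + c)) ⊆
          (Finset.univ.filter (fun x => lamZ D x ≤ (3 * (s + 1) + 1) * m)) := by
        intro z hz
        simp only [Finset.mem_union, Finset.mem_filter, Finset.mem_univ, true_and,
          Finset.mem_image] at hz ⊢
        rcases hz with hz | ⟨c, hc, rfl⟩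
        · nlinarith
        · have h1 := lamZ_add_le D (y + a) c
          have h2 := lamZ_add_le D y a
          have h3 := hT c hc
          have h4 := hT a ha
          nlinarith
      have := Finset.card_le_card hsub
      rw [Finset.card_union_of_disjoint hdis,
        Finset.card_image_of_injective _ (add_right_injective (y + a))] at this
      nlinarith

theorem lamZ_exists {G : Type u} [AddCommGroup G] [Fintype G] [DecidableEq G]
    (D T : Finset G) (hgen : AddSubgroup.closure (T : Set G) = ⊤) (hTne : T.Nonempty)
    (hD : 0 < D.card) (hn : 2 * D.card ≤ Fintype.card G) :
    ∃ a ∈ T, D.card * T.card ≤ 2 * (6 * D.card + T.card) * lamZ D a := by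
  obtain ⟨a, ha, hmax⟩ := Finset.exists_max_image T (lamZ D) hTne
  refine ⟨a, ha, ?_⟩
  have hTc : 0 < T.card := hTne.card_pos
  set s := 2 * D.card / T.card with hs
  have h1 : s * T.card ≤ 2 * D.card := Nat.div_mul_le_self _ _
  have h2 : 2 * D.card ≤ (s + 1) * T.card := by
    have := Nat.lt_mul_div_succ (2 * D.card) hTc
    rw [mul_comm (s + 1)]; exact this.le
  have h3 : 2 * D.card ≤
      (Finset.univ.filter (fun x => lamZ D x ≤ (3 * s + 1) * lamZ D a)).card := by
    rcases lamZ_growth D T (lamZ D a) hmax hgen s with h | h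
    · rw [h]; simpa using hn
    · exact h2.trans h
  have h4 := lamZ_avg D _ ((3 * s + 1) * lamZ D a) (by
    intro x hx
    simpa using hx) hD h3
  calc D.card * T.card ≤ (2 * ((3 * s + 1) * lamZ D a)) * T.card := Nat.mul_le_mul_right _ h4
    _ = 2 * (3 * (s * T.card) + T.card) * lamZ D a := by ring
    _ ≤ 2 * (3 * (2 * D.card) + T.card) * lamZ D a := by gcongr
    _ = _ := by ring

def sumsZ {G : Type u} [AddCommGroup G] [DecidableEq G] (S : Finset G) : Finset G :=
  S.powerset.image (fun s => ∑ x ∈ s, x)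

theorem sumsZ_insert {G : Type u} [AddCommGroup G] [DecidableEq G] (S : Finset G) (a : G)
    (ha : a ∉ S) : (sumsZ S).card + lamZ (sumsZ S) a ≤ (sumsZ (insert a S)).card := by
  have hdis : Disjoint (sumsZ S)
      (((sumsZ S).filter (fun b => b + a ∉ sumsZ S)).image (fun b => b + a)) := by
    rw [Finset.disjoint_left]
    intro z hz hz2
    simp only [Finset.mem_image, Finset.mem_filter] at hz2
    obtain ⟨b, hb, rfl⟩ := hz2
    exact hb.2 hz
  have hsub : sumsZ S ∪
      (((sumsZ S).filter (fun b => b + a ∉ sumsZ S)).image (fun b => b + a)) ⊆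
      sumsZ (insert a S) := by
    intro z hz
    simp only [Finset.mem_union] at hz
    rcases hz with hz | hz
    · simp only [sumsZ, Finset.mem_image, Finset.mem_powerset] at hz ⊢
      obtain ⟨s, hs, rfl⟩ := hz
      exact ⟨s, hs.trans (Finset.subset_insert _ _), rfl⟩
    · simp only [Finset.mem_image, Finset.mem_filter] at hz
      obtain ⟨b, ⟨hb, -⟩, rfl⟩ := hz
      simp only [sumsZ, Finset.mem_image, Finset.mem_powerset] at hb ⊢
      obtain ⟨s, hs, rfl⟩ := hb
      refine ⟨insert a s, Finset.insert_subset_insert _ hs, ?_⟩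
      rw [Finset.sum_insert (fun h => ha (hs h)), add_comm]
  have := Finset.card_le_card hsub
  rw [Finset.card_union_of_disjoint hdis,
    Finset.card_image_of_injective _ (add_left_injective a)] at this
  exact this

theorem subset_sumsZ {G : Type u} [AddCommGroup G] [DecidableEq G] (S : Finset G) :
    S ⊆ sumsZ S := by
  intro a ha
  simp only [sumsZ, Finset.mem_image, Finset.mem_powerset]
  exact ⟨{a}, by simpa using ha, by simp⟩

/-- One step of the greedy construction. -/
theorem step_Z {G : Type u} [AddCommGroup G] [Fintype G] [DecidableEq G]
    (A S : Finset G) (hSA : S ⊆ A)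
    (hfree : ∀ s ⊆ A, s.Nonempty → ∑ x ∈ s, x ≠ 0)
    (hgen : ∀ T ⊆ A, 18 * A.card ≤ 25 * T.card → AddSubgroup.closure (T : Set G) = ⊤)
    (hpos : 0 < A.card)
    (h1 : A.card ≤ 10 * S.card) (h2 : 25 * S.card ≤ 7 * A.card) :
    ∃ a ∈ A, a ∉ S ∧ 40 * (sumsZ S).card + A.card ≤ 40 * (sumsZ (insert a S)).card := by
  have hcard : (A \ S).card + S.card = A.card := Finset.card_sdiff_add_card_eq_card hSA
  have hN : 18 * A.card ≤ 25 * (A \ S).card := by omega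
  have hg := hgen (A \ S) Finset.sdiff_subset hN
  have hne : (A \ S).Nonempty := by
    rw [← Finset.card_pos]; omega
  have hB : S.card ≤ (sumsZ S).card := Finset.card_le_card (subset_sumsZ S)
  have hBc : (A \ S).card ≤ (sumsZ S)ᶜ.card := by
    rw [← Finset.card_image_of_injective (A \ S) neg_injective]
    apply Finset.card_le_card
    intro z hz
    simp only [Finset.mem_image] at hz
    obtain ⟨a, ha, rfl⟩ := hz
    rw [Finset.mem_sdiff] at ha
    rw [Finset.mem_compl]
    intro hmem
    simp only [sumsZ, Finset.mem_image, Finset.mem_powerset] at hmem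
    obtain ⟨s, hs, hsum⟩ := hmem
    apply hfree (insert a s)
      (Finset.insert_subset ha.1 (hs.trans hSA)) (Finset.insert_nonempty _ _)
    rw [Finset.sum_insert (fun h => ha.2 (hs h)), hsum, add_neg_cancel]
  have hcompl : (sumsZ S).card + (sumsZ S)ᶜ.card = Fintype.card G :=
    Finset.card_add_card_compl _
  have key : ∃ a ∈ A \ S, A.card ≤ 40 * lamZ (sumsZ S) a := by
    have arith : ∀ d N k l : ℕ, 0 < k → k ≤ 10 * d → 18 * k ≤ 25 * N →
        d * N ≤ 2 * (6 * d + N) * l → k ≤ 40 * l := by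
      intro d N k l hk hd hN h
      by_contra hcon
      push Not at hcon
      have a1 : 2 * (6 * d + N) * (40 * l) < 2 * (6 * d + N) * k := by
        apply Nat.mul_lt_mul_of_pos_left hcon
        omega
      have a2 : 40 * (d * N) < 2 * (6 * d + N) * k := by nlinarith
      zify at *
      nlinarith [mul_nonneg (sub_nonneg.2 hN) (by linarith : (0:ℤ) ≤ 20 * d - k),
        mul_nonneg (sub_nonneg.2 hd) hk.le]
    rcases le_total (2 * (sumsZ S).card) (Fintype.card G) with hle | hle
    · obtain ⟨a, ha, h⟩ := lamZ_exists (sumsZ S) (A \ S) hg hne (by omega) hle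
      exact ⟨a, ha, arith _ _ _ _ hpos (by omega) hN h⟩
    · obtain ⟨a, ha, h⟩ := lamZ_exists (sumsZ S)ᶜ (A \ S) hg hne (by omega) (by omega)
      rw [lamZ_compl] at h
      exact ⟨a, ha, arith _ _ _ _ hpos (by omega) hN h⟩
  obtain ⟨a, ha, h⟩ := key
  rw [Finset.mem_sdiff] at ha
  refine ⟨a, ha.1, ha.2, ?_⟩
  have := sumsZ_insert S a ha.2
  omega

theorem core_Z (n : ℕ) : ∀ (G : Type u) [AddCommGroup G] [Fintype G] [DecidableEq G]
    (A : Finset G), Fintype.card G = n → 0 ∉ A → 1024 * Fintype.card G ≤ A.card ^ 2 →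
    ∃ s ⊆ A, s.Nonempty ∧ ∑ x ∈ s, x = 0 := by
  induction n using Nat.strong_induction_on with
  | _ n ih =>
  intro G _ _ _ A hn h0 hA
  by_contra hcon
  push Not at hcon
  have hnpos : 0 < Fintype.card G := Fintype.card_pos
  have hk32 : 32 ≤ A.card := by nlinarith
  have hgen : ∀ T ⊆ A, 18 * A.card ≤ 25 * T.card → AddSubgroup.closure (T : Set G) = ⊤ := by
    intro T hTA hT
    by_contra hne
    set H := AddSubgroup.closure (T : Set G) with hH
    classical
    have hidx : 2 * Nat.card H ≤ Fintype.card G := by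
      have e1 := H.card_mul_index
      rw [Nat.card_eq_fintype_card (α := G)] at e1
      have e2 : H.index ≠ 1 := by
        rw [Ne, AddSubgroup.index_eq_one]; exact hne
      have e3 : H.index ≠ 0 := AddSubgroup.index_ne_zero_of_finite
      have e4 : 2 ≤ H.index := by omega
      nlinarith
    rw [Nat.card_eq_fintype_card] at hidx
    have hTH : ∀ x ∈ T, x ∈ H := fun x hx => AddSubgroup.subset_closure hx
    have hc : (T.subtype (· ∈ H)).card = T.card := by
      rw [Finset.card_subtype, Finset.filter_true_of_mem hTH]
    obtain ⟨s, hs, hsne, hsum⟩ := ih (Fintype.card H) (by omega) H (T.subtype (· ∈ H)) rfl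
      (by
        rw [Finset.mem_subtype]
        intro h
        exact h0 (hTA h))
      (by
        rw [hc]
        nlinarith)
    apply hcon (s.map (Function.Embedding.subtype _)) _ (by simpa using hsne)
    · rw [Finset.sum_map]
      have := congrArg (fun x : H => (x : G)) hsum
      simpa using this
    · intro x hx
      rw [Finset.mem_map] at hx
      obtain ⟨y, hy, rfl⟩ := hx
      have := hs hy
      rw [Finset.mem_subtype] at this
      exact hTA this
  set k := A.card with hk
  set j := k / 10 + 1 with hj
  obtain ⟨S0, hS0, hS0c⟩ := Finset.exists_subset_card_eq (s := A) (n := j) (by omega)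
  have main : ∀ i, 25 * (j + i) ≤ 7 * k + 25 →
      ∃ S ⊆ A, S.card = j + i ∧ i * k ≤ 40 * (sumsZ S).card := by
    intro i
    induction i with
    | zero => intro _; exact ⟨S0, hS0, by simpa using hS0c, by simp⟩
    | succ i ihi =>
      intro hi
      obtain ⟨S, hSA, hSc, hS⟩ := ihi (by omega)
      obtain ⟨a, haA, haS, h⟩ := step_Z A S hSA hcon hgen (by omega) (by omega) (by omega)
      refine ⟨insert a S, Finset.insert_subset haA hSA, ?_, ?_⟩
      · rw [Finset.card_insert_of_notMem haS]; omega
      · nlinarith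
  obtain ⟨S, _, _, hS⟩ := main (k / 10) (by omega)
  have hle : (sumsZ S).card ≤ Fintype.card G := Finset.card_le_univ _
  have hk10 : k ≤ 10 * (k / 10) + 9 := by omega
  have : 3 * k ≤ 40 * (k / 10) := by omega
  nlinarith

end Aux

theorem zero_sum_of_many_distinct {G : Type*} [AddCommGroup G] [Fintype G] [DecidableEq G]
    (A : Multiset G)
    (h : 32 * Real.sqrt (Fintype.card G) ≤ ((A.toFinset.filter (fun a => a ≠ 0)).card : ℝ)) :
    ∃ s : Multiset G, s ≤ A ∧ s ≠ 0 ∧ s.sum = 0 := by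
  obtain ⟨s, hs, hne, hsum⟩ := core_Z (Fintype.card G) G (A.toFinset.filter (fun a => a ≠ 0)) rfl
    (by simp) (by
      have h1 : (32 * Real.sqrt (Fintype.card G)) ^ 2 ≤
          ((A.toFinset.filter (fun a => a ≠ 0)).card : ℝ) ^ 2 := by gcongr
      rw [mul_pow, Real.sq_sqrt (by positivity)] at h1
      norm_num at h1
      exact_mod_cast h1)
  refine ⟨s.val, ?_, ?_, ?_⟩
  · rw [Multiset.le_iff_subset s.nodup]
    intro x hx
    have := hs (by simpa using hx)
    simp only [Finset.mem_filter, Multiset.mem_toFinset] at this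
    exact this.1
  · simpa using hne.ne_empty
  · rw [← hsum, Finset.sum, Multiset.map_id']
end

section
/- Let q be a positive integer and let A = {a_1,…,a_d} ⊆ ℤ/qℤ be a multiset where each a_k has multiplicity n_k and gcd(a_k, q) = 1 for all k. For m ≥ 1 let α(m) = #{1 ≤ k ≤ d : n_k ≥ m}. If Σ*(A) ≠ ℤ/qℤ, then α(m) ≤ 9·√(q/m) for all positive integers m. -/
open Finset in
/-- the amount by which `B` grows under translation by `x`. -/
def lamB {q : ℕ} (B : Finset (ZMod q)) (x : ZMod q) : ℕ := ((B.image (· + x)) \ B).card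

theorem unit_closed {q : ℕ} [NeZero q] (B : Finset (ZMod q)) (hB : B.Nonempty) (x : ZMod q)
    (hx : IsUnit x) (h : ∀ b ∈ B, b + x ∈ B) : B = Finset.univ := by
  obtain ⟨b, hb⟩ := hB
  have key : ∀ k : ℕ, b + k * x ∈ B := by
    intro k
    induction k with
    | zero => simpa using hb
    | succ k ih =>
      have := h _ ih
      convert this using 1
      push_cast; ring
  ext y
  simp only [Finset.mem_univ, iff_true]
  obtain ⟨u, rfl⟩ := hx
  have := key ((y - b) * (↑u⁻¹ : ZMod q)).val
  rw [ZMod.natCast_val, ZMod.cast_id', id, mul_assoc, Units.inv_mul] at this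
  simpa using this

theorem lamB_pos {q : ℕ} [NeZero q] (B : Finset (ZMod q)) (hB : B.Nonempty) (hB' : 2 * B.card ≤ q)
    (x : ZMod q) (hx : IsUnit x) : 1 ≤ lamB B x := by
  by_contra hc
  have h0 : lamB B x = 0 := by omega
  unfold lamB at h0
  rw [Finset.card_eq_zero, Finset.sdiff_eq_empty_iff_subset] at h0
  have := unit_closed B hB x hx (fun b hb => h0 (Finset.mem_image_of_mem _ hb))
  have hc := hB.card_pos
  rw [this, Finset.card_univ, ZMod.card] at hB' hc
  omega

theorem lamB_add {q : ℕ} (B : Finset (ZMod q)) (x y : ZMod q) :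
    lamB B (x + y) ≤ lamB B x + lamB B y := by
  unfold lamB
  have : (B.image (· + (x + y))) \ B ⊆
      (((B.image (· + x)) \ B).image (· + y)) ∪ ((B.image (· + y)) \ B) := by
    intro z hz
    simp only [Finset.mem_sdiff, Finset.mem_image, Finset.mem_union] at hz ⊢
    obtain ⟨⟨b, hb, rfl⟩, hz⟩ := hz
    by_cases hbx : b + x ∈ B
    · right
      exact ⟨⟨b + x, hbx, by ring⟩, hz⟩
    · left
      exact ⟨b + x, ⟨⟨b, hb, rfl⟩, hbx⟩, by ring⟩
  refine (Finset.card_le_card this).trans ((Finset.card_union_le _ _).trans ?_)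
  exact Nat.add_le_add_right Finset.card_image_le _

theorem lamB_zero {q : ℕ} (B : Finset (ZMod q)) : lamB B 0 = 0 := by
  simp [lamB]

open scoped Pointwise in
/-- Chowla's theorem. -/
theorem chowla {q : ℕ} [NeZero q] (k : ℕ) : ∀ (B T : Finset (ZMod q)), T.card = k → B.Nonempty →
    0 ∈ T → (∀ t ∈ T, t ≠ 0 → IsUnit t) → min q (B.card + T.card - 1) ≤ (B + T).card := by
  induction k using Nat.strong_induction_on with
  | _ k ih =>
  intro B T hk hB h0 hT
  by_cases hall : ∀ b ∈ B, ∀ t ∈ T, b + t ∈ B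
  · by_cases ht : ∃ t ∈ T, t ≠ 0
    · obtain ⟨t, ht, ht0⟩ := ht
      have := unit_closed B hB t (hT t ht ht0) (fun b hb => hall b hb t ht)
      have h2 : B ⊆ B + T := fun b hb => Finset.mem_add.2 ⟨b, hb, 0, h0, by simp⟩
      have h3 := Finset.card_le_card h2
      have h4 : B.card = q := by rw [this, Finset.card_univ, ZMod.card]
      omega
    · push Not at ht
      have : T = {0} := by
        ext t
        simp only [Finset.mem_singleton]
        exact ⟨ht t, fun h => h ▸ h0⟩
      subst this
      simp
  · push Not at hall
    obtain ⟨b, hb, t, ht, hbt⟩ := hall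
    set T' := T.filter (fun t => b + t ∈ B) with hT'
    set B' := B ∪ T.image (b + ·) with hB'
    have hsub : B' + T' ⊆ B + T := by
      intro z hz
      obtain ⟨c, hc, s, hs, rfl⟩ := Finset.mem_add.1 hz
      rw [hT', Finset.mem_filter] at hs
      rw [hB', Finset.mem_union, Finset.mem_image] at hc
      rcases hc with hc | ⟨r, hr, rfl⟩
      · exact Finset.add_mem_add hc hs.1
      · exact Finset.mem_add.2 ⟨b + s, hs.2, r, hr, by ring⟩
    have hlt : T'.card < T.card := Finset.card_lt_card (by
      refine Finset.filter_ssubset.2 ⟨t, ht, hbt⟩)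
    have hcard : B'.card + T'.card = B.card + T.card := by
      have h1 := Finset.card_union_add_card_inter B (T.image (b + ·))
      have h2 : (T.image (b + ·)).card = T.card :=
        Finset.card_image_of_injective _ (add_right_injective b)
      have h3 : B ∩ T.image (b + ·) = T'.image (b + ·) := by
        ext z
        simp only [hT', Finset.mem_inter, Finset.mem_image, Finset.mem_filter]
        constructor
        · rintro ⟨hz, r, hr, rfl⟩
          exact ⟨r, ⟨hr, hz⟩, rfl⟩
        · rintro ⟨r, ⟨hr, hz⟩, rfl⟩
          exact ⟨hz, r, hr, rfl⟩
      have h4 : (T'.image (b + ·)).card = T'.card :=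
        Finset.card_image_of_injective _ (add_right_injective b)
      rw [h3, h4, h2] at h1
      exact h1
    have := ih T'.card (by omega) B' T' rfl (hB.mono Finset.subset_union_left)
      (by simp [hT', h0, hb]) (fun t ht => hT t (Finset.mem_filter.1 ht).1)
    have h5 := Finset.card_le_card hsub
    omega

open scoped Pointwise in
theorem exists_big {q : ℕ} [NeZero q] (B D : Finset (ZMod q)) (hD : ∀ d ∈ D, IsUnit d)
    (hD0 : (0 : ZMod q) ∉ D)
    (L : ℕ) (hL : ∀ d ∈ D, lamB B d ≤ L) (k : ℕ) :
    ∃ Y : Finset (ZMod q), Y.Nonempty ∧ min q (k * D.card + 1) ≤ Y.card ∧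
      ∀ y ∈ Y, lamB B y ≤ k * L := by
  induction k with
  | zero => exact ⟨{0}, by simp, by simp, by simp [lamB_zero]⟩
  | succ k ih =>
    obtain ⟨Y, hY, hc, hl⟩ := ih
    refine ⟨Y + insert 0 D, hY.add (Finset.insert_nonempty _ _), ?_, ?_⟩
    · have := chowla _ Y (insert 0 D) rfl hY (by simp) (by
        intro t ht h0
        rcases Finset.mem_insert.1 ht with h | h
        · exact absurd h h0
        · exact hD t h)
      rw [Finset.card_insert_of_notMem hD0] at this
      have h2 : (k + 1) * D.card = k * D.card + D.card := by ring
      rw [h2]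
      omega
    · intro y hy
      obtain ⟨c, hc, s, hs, rfl⟩ := Finset.mem_add.1 hy
      have h1 := lamB_add B c s
      have h2 := hl c hc
      have h3 : lamB B s ≤ L := by
        rcases Finset.mem_insert.1 hs with h | h
        · rw [h, lamB_zero]; omega
        · exact hL s h
      have h4 : (k + 1) * L = k * L + L := by ring
      omega

theorem sum_inter {q : ℕ} (B Y : Finset (ZMod q)) :
    Y.card * B.card ≤ ∑ y ∈ Y, lamB B y + B.card * B.card := by
  have h1 : ∀ y, (B.image (· + y) ∩ B).card + lamB B y = B.card := by
    intro y
    unfold lamB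
    rw [Finset.card_inter_add_card_sdiff,
      Finset.card_image_of_injective _ (add_left_injective y)]
  have h2 : ∑ y ∈ Y, (B.image (· + y) ∩ B).card ≤ B.card * B.card := by
    rw [← Finset.card_sigma, ← Finset.card_product]
    refine Finset.card_le_card_of_injOn (fun p => (p.2, p.2 - p.1)) ?_ ?_
    · rintro ⟨y, z⟩ hp
      simp only [Finset.coe_sigma, Set.mem_sigma_iff, Finset.mem_coe, Finset.mem_inter,
        Finset.mem_image, Finset.coe_product, Set.mem_prod] at hp ⊢
      obtain ⟨_, ⟨b, hb, rfl⟩, hz⟩ := hp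
      exact ⟨hz, by simpa using hb⟩
    · rintro ⟨y, z⟩ _ ⟨y', z'⟩ _ h
      simp only [Prod.mk.injEq] at h
      obtain ⟨rfl, h⟩ := h
      have : y = y' := by simpa using h
      subst this; rfl
  have h3 : ∑ y ∈ Y, ((B.image (· + y) ∩ B).card + lamB B y) = Y.card * B.card := by
    rw [Finset.sum_congr rfl (fun y _ => h1 y)]; simp
  rw [Finset.sum_add_distrib] at h3
  omega

theorem gain {q : ℕ} [NeZero q] (B D : Finset (ZMod q)) (hB : B.Nonempty) (hB' : 2 * B.card ≤ q)
    (hDn : D.Nonempty) (hD : ∀ d ∈ D, IsUnit d) (hND : D.card ≤ 4 * B.card) :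
    ∃ d ∈ D, D.card ≤ 8 * lamB B d := by
  obtain ⟨d, hd, hmax⟩ := D.exists_max_image (lamB B) hDn
  refine ⟨d, hd, ?_⟩
  have hb := hB.card_pos
  have hn := hDn.card_pos
  have hD0 : (0 : ZMod q) ∉ D := by
    intro h0
    have := lamB_pos B hB hB' 0 (hD 0 h0)
    rw [lamB_zero] at this
    omega
  obtain ⟨Y, hY, hc, hl⟩ := exists_big B D hD hD0 (lamB B d) hmax (2 * B.card / D.card + 1)
  set k := 2 * B.card / D.card + 1 with hk
  set L := lamB B d
  have e1 : 2 * B.card < k * D.card := by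
    rw [hk, mul_comm _ D.card]
    exact Nat.lt_mul_div_succ _ hn
  have e2 : k * D.card ≤ 4 * B.card := by
    rw [hk]
    by_cases h : D.card ≤ 2 * B.card
    · have := Nat.div_mul_le_self (2 * B.card) D.card
      rw [add_mul]; omega
    · rw [Nat.div_eq_of_lt (by omega)]; omega
  have e3 : 2 * B.card ≤ Y.card := by omega
  have e4 := sum_inter B Y
  have e5 : ∑ y ∈ Y, lamB B y ≤ Y.card * (k * L) := by
    simpa using Finset.sum_le_card_nsmul Y _ _ hl
  have e6 : B.card ≤ 2 * (k * L) := by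
    by_contra hcon
    push Not at hcon
    generalize k * L = z at *
    nlinarith
  have e7 : B.card * D.card ≤ B.card * (8 * L) := by nlinarith
  exact Nat.le_of_mul_le_mul_left e7 hb

/-- set of all subset sums (including the empty one). -/
def sig {q : ℕ} (U : Multiset (ZMod q)) : Finset (ZMod q) := (U.powerset.map Multiset.sum).toFinset

theorem mem_sig {q : ℕ} (U : Multiset (ZMod q)) (x : ZMod q) :
    x ∈ sig U ↔ ∃ s, s ≤ U ∧ s.sum = x := by
  simp [sig]

theorem sig_nonempty {q : ℕ} (U : Multiset (ZMod q)) : (sig U).Nonempty :=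
  ⟨0, (mem_sig _ _).2 ⟨0, by simp, by simp⟩⟩

theorem sig_cons {q : ℕ} (U : Multiset (ZMod q)) (x : ZMod q) :
    (sig U).card + lamB (sig U) x ≤ (sig (x ::ₘ U)).card := by
  unfold lamB
  rw [← Finset.card_union_of_disjoint Finset.disjoint_sdiff]
  apply Finset.card_le_card
  intro z hz
  rw [mem_sig]
  rcases Finset.mem_union.1 hz with h | h
  · obtain ⟨s, hs, rfl⟩ := (mem_sig _ _).1 h
    exact ⟨s, hs.trans (Multiset.le_cons_self _ _), rfl⟩
  · obtain ⟨w, hw, rfl⟩ := Finset.mem_image.1 (Finset.mem_sdiff.1 h).1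
    obtain ⟨s, hs, rfl⟩ := (mem_sig _ _).1 hw
    exact ⟨x ::ₘ s, Multiset.cons_le_cons _ hs, by simp [add_comm]⟩

theorem half {q : ℕ} [NeZero q] (D : Finset (ZMod q)) (hD : ∀ d ∈ D, IsUnit d) (m : ℕ) (hm : 1 ≤ m)
    (hh : 4 ≤ D.card) (hbig : 16 * q ≤ m * D.card ^ 2) :
    ∃ U, U < m • D.val ∧ q < 2 * (sig U).card := by
  by_contra hcon
  push Not at hcon
  set h := D.card with hhdef
  have hq : 0 < q := Nat.pos_of_ne_zero (NeZero.ne q)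
  have hcardA : (m • D.val).card = m * h := by simp [hhdef]
  set K := m * h - h / 4 with hK
  have hmh : h ≤ m * h := Nat.le_mul_of_pos_left _ hm
  have main : ∀ t, t + 1 ≤ m * h → ∃ U, U ≤ m • D.val ∧ U.card = t ∧ t + 1 ≤ (sig U).card ∧
      (h / 4 ≤ t → K * (K + 1) ≤ 16 * m * (sig U).card + (m * h - t) * (m * h - t + 1)) := by
    intro t
    induction t with
    | zero =>
      intro _
      refine ⟨0, by simp, by simp, ?_, ?_⟩
      · exact (sig_nonempty _).card_pos
      · intro h0
        have : K = m * h := by omega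
        rw [this]; simp
    | succ t ih =>
      intro ht
      obtain ⟨U, hU, hUc, hs, hinv⟩ := ih (by omega)
      have hUlt : U < m • D.val := lt_of_le_of_ne hU (by
        intro he
        rw [he, hcardA] at hUc; omega)
      have hq2 := hcon U hUlt
      set R := m • D.val - U with hR
      have hRc : R.card = m * h - t := by
        rw [hR, Multiset.card_sub hU, hcardA, hUc]
      have hRD : R.toFinset ⊆ D := by
        intro x hx
        have h1 := Multiset.mem_of_le (Multiset.sub_le_self _ _) (Multiset.mem_toFinset.1 hx)
        have h2 : x ∈ D.val := Multiset.mem_of_mem_nsmul h1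
        simpa using h2
      have hRN : m * h - t ≤ m * R.toFinset.card := by
        rw [← hRc, ← Multiset.toFinset_sum_count_eq, mul_comm]
        apply Finset.sum_le_card_nsmul
        intro x _
        calc R.count x ≤ (m • D.val).count x :=
              Multiset.count_le_of_le _ (Multiset.sub_le_self _ _)
          _ ≤ m := by
            rw [Multiset.count_nsmul]
            have := Multiset.nodup_iff_count_le_one.1 D.nodup x
            nlinarith
      have hRne : R.toFinset.Nonempty := by
        rw [← Finset.card_pos]
        by_contra h0
        have : R.toFinset.card = 0 := by omega
        rw [this] at hRN; omega
      have hstep : ∀ x ∈ R.toFinset, x ::ₘ U ≤ m • D.val := by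
        intro x hx
        have h1 : {x} ≤ R := Multiset.singleton_le.2 (Multiset.mem_toFinset.1 hx)
        have h2 := add_le_add_left h1 U
        rw [hR, Multiset.sub_add_cancel hU] at h2
        simpa using h2
      have hpick : ∃ x ∈ R.toFinset, 1 ≤ lamB (sig U) x ∧
          (h / 4 ≤ t → R.toFinset.card ≤ 8 * lamB (sig U) x) := by
        by_cases hht : h / 4 ≤ t
        · have hle := Finset.card_le_card hRD
          obtain ⟨x, hx, hg⟩ := gain (sig U) R.toFinset (sig_nonempty U) hq2 hRne
            (fun d hd => hD d (hRD hd)) (by omega)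
          exact ⟨x, hx, lamB_pos _ (sig_nonempty U) hq2 x (hD x (hRD hx)), fun _ => hg⟩
        · obtain ⟨x, hx⟩ := hRne
          exact ⟨x, hx, lamB_pos _ (sig_nonempty U) hq2 x (hD x (hRD hx)), fun h0 => absurd h0 hht⟩
      obtain ⟨x, hx, hl1, hl2⟩ := hpick
      have hsc := sig_cons U x
      refine ⟨x ::ₘ U, hstep x hx, by simp [hUc], by omega, ?_⟩
      intro hht
      by_cases hht' : h / 4 ≤ t
      · have h1 := hinv hht'
        have h2 := hl2 hht'
        obtain ⟨r, hr⟩ : ∃ r, m * h - t = r + 1 := ⟨m * h - t - 1, by omega⟩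
        have hr' : m * h - (t + 1) = r := by omega
        rw [hr'] 
        rw [hr] at h1 hRN
        have h3 : m * R.toFinset.card ≤ m * (8 * lamB (sig U) x) := Nat.mul_le_mul_left _ h2
        have h4 := Nat.mul_le_mul_left (16 * m) hsc
        nlinarith
      · have : h / 4 = t + 1 := by omega
        rw [hK, this]
        exact Nat.le_add_left _ _
  obtain ⟨U, hU, hUc, hs, hinv⟩ := main (m * h - 1) (by omega)
  have hUlt : U < m • D.val := lt_of_le_of_ne hU (by
    intro he
    rw [he, hcardA] at hUc; omega)
  have hq2 := hcon U hUlt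
  have h1 := hinv (by omega)
  have h2 : m * h - (m * h - 1) = 1 := by omega
  rw [h2] at h1
  have h3 : 3 * (m * h) ≤ 4 * K := by omega
  have h4 : 2 ≤ K := by omega
  have h5 : K ^ 2 ≤ 16 * m * (sig U).card := by nlinarith
  have h6 : 16 * m * (sig U).card ≤ 8 * m * q := by
    have := Nat.mul_le_mul_left (8 * m) hq2
    nlinarith
  have h7 : (3 * (m * h)) ^ 2 ≤ (4 * K) ^ 2 := Nat.pow_le_pow_left h3 2
  have h8 : m * (16 * q) ≤ m * (m * h ^ 2) := Nat.mul_le_mul_left _ hbig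
  have h9 : 0 < m * q := Nat.mul_pos hm hq
  nlinarith

theorem nat_bound (q : ℕ) (hq : 0 < q) (A : Multiset (ZMod q))
    (hA : ∀ a ∈ A, IsUnit a)
    (hinc : ∃ x : ZMod q, ∀ s : Multiset (ZMod q), s ≤ A → s ≠ 0 → s.sum ≠ x)
    (m : ℕ) (hm : 1 ≤ m) :
    m * (A.toFinset.filter (fun a => m ≤ A.count a)).card ^ 2 ≤ 81 * q := by
  have : NeZero q := ⟨hq.ne'⟩
  by_contra hcon
  push Not at hcon
  obtain ⟨x, hx⟩ := hinc
  set S := A.toFinset.filter (fun a => m ≤ A.count a) with hS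
  have hSu : ∀ a ∈ S, IsUnit a := fun a ha =>
    hA a (Multiset.mem_toFinset.1 (Finset.mem_filter.1 ha).1)
  by_cases hmq : q ≤ m
  · have hne : S.Nonempty := by
      rw [← Finset.card_pos]
      by_contra h0
      have : S.card = 0 := by omega
      rw [this] at hcon; simp at hcon
    obtain ⟨a, ha⟩ := hne
    have hc := (Finset.mem_filter.1 ha).2
    obtain ⟨u, hu⟩ := hSu a ha
    have hj : ∃ j : ℕ, 1 ≤ j ∧ j ≤ q ∧ (j : ZMod q) = x * (↑u⁻¹ : ZMod q) := by
      by_cases h0 : (x * (↑u⁻¹ : ZMod q)).val = 0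
      · refine ⟨q, hq, le_rfl, ?_⟩
        rw [ZMod.val_eq_zero] at h0
        rw [h0]; simp
      · exact ⟨(x * (↑u⁻¹ : ZMod q)).val, by omega, (ZMod.val_lt _).le, by
          rw [ZMod.natCast_val, ZMod.cast_id', id]⟩
    obtain ⟨j, hj1, hj2, hj3⟩ := hj
    refine hx (Multiset.replicate j a) (Multiset.le_count_iff_replicate_le.1 (by omega)) ?_ ?_
    · intro h0
      have := congrArg Multiset.card h0
      simp at this; omega
    · rw [Multiset.sum_replicate, nsmul_eq_mul, hj3, ← hu, mul_assoc, Units.inv_mul, mul_one]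
  · push Not at hmq
    have hn : 10 ≤ S.card := by
      by_contra h0
      have h1 : S.card ≤ 9 := by omega
      have h2 : S.card ^ 2 ≤ 9 ^ 2 := Nat.pow_le_pow_left h1 2
      have := Nat.mul_le_mul_left m h2
      omega
    set h := S.card / 2 with hh
    obtain ⟨D1, hD1, hc1⟩ := Finset.exists_subset_card_eq (s := S) (n := h) (by omega)
    obtain ⟨D2, hD2, hc2⟩ := Finset.exists_subset_card_eq (s := S \ D1) (n := h) (by
      rw [Finset.card_sdiff_of_subset hD1]; omega)
    have hD2S : D2 ⊆ S := hD2.trans Finset.sdiff_subset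
    have hbig : 16 * q ≤ m * h ^ 2 := by
      have h1 : 9 * S.card ≤ 20 * h := by omega
      have h2 := Nat.mul_le_mul_left m (Nat.pow_le_pow_left h1 2)
      nlinarith
    obtain ⟨U1, hU1, hq1⟩ := half D1 (fun d hd => hSu d (hD1 hd)) m hm (by omega) (by rwa [hc1])
    obtain ⟨U2, hU2, hq2⟩ := half D2 (fun d hd => hSu d (hD2S hd)) m hm (by omega) (by rwa [hc2])
    obtain ⟨a, ha⟩ := Multiset.lt_iff_cons_le.1 hU1
    have hle : m • D1.val + m • D2.val ≤ A := by
      rw [Multiset.le_iff_count]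
      intro b
      rw [Multiset.count_add, Multiset.count_nsmul, Multiset.count_nsmul]
      by_cases hb1 : b ∈ D1
      · have hb2 : b ∉ D2 := fun hb => (Finset.mem_sdiff.1 (hD2 hb)).2 hb1
        rw [Multiset.count_eq_zero_of_notMem (by simpa using hb2 : b ∉ D2.val),
          Multiset.count_eq_one_of_mem D1.nodup (by simpa using hb1)]
        simpa using (Finset.mem_filter.1 (hD1 hb1)).2
      · rw [Multiset.count_eq_zero_of_notMem (by simpa using hb1 : b ∉ D1.val)]
        by_cases hb2 : b ∈ D2
        · rw [Multiset.count_eq_one_of_mem D2.nodup (by simpa using hb2)]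
          simpa using (Finset.mem_filter.1 (hD2S hb2)).2
        · rw [Multiset.count_eq_zero_of_notMem (by simpa using hb2 : b ∉ D2.val)]
          simp
    have hpig : ∃ y ∈ sig U1, (x - a) - y ∈ sig U2 := by
      by_contra hno
      push Not at hno
      have hdisj : Disjoint ((sig U1).image (fun y => (x - a) - y)) (sig U2) := by
        rw [Finset.disjoint_left]
        intro z hz
        obtain ⟨y, hy, rfl⟩ := Finset.mem_image.1 hz
        exact hno y hy
      have h1 := Finset.card_union_of_disjoint hdisj
      rw [Finset.card_image_of_injective _ (sub_right_injective)] at h1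
      have h2 := Finset.card_le_univ ((sig U1).image (fun y => (x - a) - y) ∪ sig U2)
      rw [ZMod.card] at h2
      omega
    obtain ⟨y, hy1, hy2⟩ := hpig
    obtain ⟨s1, hs1, e1⟩ := (mem_sig _ _).1 hy1
    obtain ⟨s2, hs2, e2⟩ := (mem_sig _ _).1 hy2
    refine hx ((a ::ₘ s1) + s2) ?_ ?_ ?_
    · refine le_trans (add_le_add ((Multiset.cons_le_cons a hs1).trans ha) (hs2.trans hU2.le)) hle
    · simp
    · rw [Multiset.sum_add, Multiset.sum_cons, e1, e2]; ring

theorem incomplete_multiplicity_bound (q : ℕ) (hq : 0 < q) (A : Multiset (ZMod q))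
    (hA : ∀ a ∈ A, IsUnit a)
    (hinc : ∃ x : ZMod q, ∀ s : Multiset (ZMod q), s ≤ A → s ≠ 0 → s.sum ≠ x)
    (m : ℕ) (hm : 1 ≤ m) :
    ((A.toFinset.filter (fun a => m ≤ A.count a)).card : ℝ) ≤
      9 * Real.sqrt ((q : ℝ) / m) := by
  have h := nat_bound q hq A hA hinc m hm
  set n := (A.toFinset.filter (fun a => m ≤ A.count a)).card
  have h' : (m : ℝ) * (n : ℝ) ^ 2 ≤ 81 * q := by exact_mod_cast h
  have hm' : (0 : ℝ) < m := by exact_mod_cast hm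
  have h2 : (n : ℝ) / 9 ≤ Real.sqrt ((q : ℝ) / m) := by
    apply Real.le_sqrt_of_sq_le
    rw [le_div_iff₀ hm']
    nlinarith
  linarith
end
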